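/- arXiv:1208.4854 — 2 statements merged into one kernel-verified Lean document; each statement's English description precedes it below -/
import Mathlib

section
/- For every integer n ≥ 1 and every integer j ≥ 2, |db(n,j)| ≤ (3/4) · ∏_{k=1}^{n−1} (2k)/(2k+1), i.e., |db(n,j)| ≤ (3/4) · (2·4·6⋯(2n−2))/(3·5·7⋯(2n−1)) (the empty product being 1 when n = 1). -/
open scoped Classical

/-- A deal of size `n` is a fixed-point-free involution of `Fin (2*n)`. -/
def IsDeal (n : ℕ) (π : Fin (2*n) → Fin (2*n)) : Prop :=
  ∀ j, π (π j) = j ∧ π j ≠ j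

/-- The finite set `D_n` of all deals of size `n`. -/
noncomputable def deals (n : ℕ) : Finset (Fin (2*n) → Fin (2*n)) :=
  Finset.univ.filter (IsDeal n)

/-- The second occurrences of `π` (positions `j` with `π j < j`), in
increasing order: `j_1 < j_2 < ... < j_n`. -/
def blockEnds {n : ℕ} (π : Fin (2*n) → Fin (2*n)) : List (Fin (2*n)) :=
  (Finset.univ.filter (fun j => π j < j)).sort (· ≤ ·)

/-- The block lengths `b_1, ..., b_n` of a deal:
`b_1 = j_1 + 1` and `b_i = j_i - j_(i-1)` for `i ≥ 2`. -/
def blockLens {n : ℕ} (π : Fin (2*n) → Fin (2*n)) : List ℕ :=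
  List.zipWith (fun x y => x - y)
    ((blockEnds π).map (fun j => (j : ℕ) + 1))
    (0 :: (blockEnds π).map (fun j => (j : ℕ) + 1))

/-- The blocks of a deal: each block length `b_i` paired with the ending
position `j_i` of the block. -/
def blocks {n : ℕ} (π : Fin (2*n) → Fin (2*n)) : List (ℕ × Fin (2*n)) :=
  List.zip (blockLens π) (blockEnds π)

/-- The `i`-th block (ending at position `j_i`) is lucky if `π j_i = j_i - 1`. -/
def IsLuckyEnd {n : ℕ} (π : Fin (2*n) → Fin (2*n)) (j : Fin (2*n)) : Prop :=
  (π j).val = (j : ℕ) - 1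

/-- `b(n,j)`: total number of blocks of length `j` over all deals in `D_n`. -/
noncomputable def bcount (n j : ℕ) : ℕ :=
  ∑ π ∈ deals n, (blockLens π).count j

/-- `l(n,j)`: total number of lucky blocks of length `j` over all deals in `D_n`. -/
noncomputable def lcount (n j : ℕ) : ℕ :=
  ∑ π ∈ deals n, (blocks π).countP (fun p => decide (p.1 = j ∧ IsLuckyEnd π p.2))

/-- `eb(n,j)`: the expected number of blocks of length `j` in a random deal. -/
noncomputable def eb (n j : ℕ) : ℝ := (bcount n j : ℝ) / ((deals n).card : ℝ)

/-- `el(n,j)`: the expected number of lucky blocks of length `j` in a random deal. -/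
noncomputable def el (n j : ℕ) : ℝ := (lcount n j : ℝ) / ((deals n).card : ℝ)

/-- `db(n,j) = eb(n,j) - 2(2n+1)/(j(j+1)(j+2))`. -/
noncomputable def db (n j : ℕ) : ℝ :=
  eb n j - 2*(2*(n:ℝ)+1) / ((j:ℝ) * ((j:ℝ)+1) * ((j:ℝ)+2))

/-- `dl(n,j) = el(n,j) - 1/(j(j-1))`. -/
noncomputable def dl (n j : ℕ) : ℝ :=
  el n j - 1 / ((j:ℝ) * ((j:ℝ)-1))

/-- `e(π)`: the number of blocks of `π` of even length. -/
noncomputable def evenBlocks {n : ℕ} (π : Fin (2*n) → Fin (2*n)) : ℕ :=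
  (blockLens π).countP (fun b => decide (Even b))

/-- `l(π)`: the number of even-length lucky blocks of `π`. -/
noncomputable def luckyEvenBlocks {n : ℕ} (π : Fin (2*n) → Fin (2*n)) : ℕ :=
  (blocks π).countP (fun p => decide (Even p.1 ∧ IsLuckyEnd π p.2))

open scoped Nat

/-! ### Deals in which prescribed positions are matched into a prescribed set -/

theorem IsDeal.injective {n : ℕ} {π : Fin (2*n) → Fin (2*n)} (h : IsDeal n π) :
    Function.Injective π :=
  Function.LeftInverse.injective fun j => (h j).1

theorem mem_deals {n : ℕ} {π : Fin (2*n) → Fin (2*n)} : π ∈ deals n ↔ IsDeal n π := by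
  simp [deals]

theorem deals_nonempty (n : ℕ) : (deals n).Nonempty := by
  refine ⟨Fin.rev, mem_deals.2 fun j => ⟨Fin.rev_rev j, fun h => ?_⟩⟩
  have := congrArg Fin.val h
  rw [Fin.val_rev] at this
  omega

/-- The deals matching every position of `W` with a position of `R`. -/
noncomputable def dealsInto (n : ℕ) (W R : Finset (Fin (2*n))) :
    Finset (Fin (2*n) → Fin (2*n)) :=
  (deals n).filter fun π => ∀ x ∈ W, π x ∈ R

theorem mem_dealsInto {n : ℕ} {W R : Finset (Fin (2*n))} {π : Fin (2*n) → Fin (2*n)} :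
    π ∈ dealsInto n W R ↔ IsDeal n π ∧ ∀ x ∈ W, π x ∈ R := by
  simp [dealsInto, mem_deals]

/-- The conjugate of `π` by the transposition of `π w` and `z`. -/
def rematch {n : ℕ} (w z : Fin (2*n)) (π : Fin (2*n) → Fin (2*n)) : Fin (2*n) → Fin (2*n) :=
  fun x => Equiv.swap (π w) z (π (Equiv.swap (π w) z x))

theorem IsDeal.rematch {n : ℕ} {π : Fin (2*n) → Fin (2*n)} (h : IsDeal n π) (w z : Fin (2*n)) :
    IsDeal n (rematch w z π) := by
  refine fun x => ⟨by simp [_root_.rematch, (h _).1], fun hx => ?_⟩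
  have := congrArg (Equiv.swap (π w) z) hx
  simp only [_root_.rematch, Equiv.swap_apply_self] at this
  exact (h _).2 this

theorem rematch_apply_self {n : ℕ} {π : Fin (2*n) → Fin (2*n)} (h : IsDeal n π)
    {w z : Fin (2*n)} (hz : z ≠ w) : rematch w z π w = z := by
  rw [rematch, Equiv.swap_apply_of_ne_of_ne (h w).2.symm hz.symm, Equiv.swap_apply_left]

theorem rematch_rematch {n : ℕ} {π : Fin (2*n) → Fin (2*n)} (h : IsDeal n π)
    {w z : Fin (2*n)} (hz : z ≠ w) : rematch w (π w) (rematch w z π) = π := by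
  funext x
  rw [rematch, rematch_apply_self h hz, Equiv.swap_comm]
  simp [rematch]

/-- The positions available as a partner of `w` once the partners of `W` are chosen. -/
def freePartners {n : ℕ} (W : Finset (Fin (2*n))) (w : Fin (2*n)) (π : Fin (2*n) → Fin (2*n)) :
    Finset (Fin (2*n)) :=
  Finset.univ \ insert w (W ∪ W.image π)

theorem mem_freePartners {n : ℕ} {W : Finset (Fin (2*n))} {w z : Fin (2*n)}
    {π : Fin (2*n) → Fin (2*n)} :
    z ∈ freePartners W w π ↔ z ≠ w ∧ z ∉ W ∧ ∀ x ∈ W, π x ≠ z := by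
  simp [freePartners]

section Count

variable {n : ℕ} {W R : Finset (Fin (2*n))} {w : Fin (2*n)} {π : Fin (2*n) → Fin (2*n)}

theorem rematch_apply_of_mem {z x : Fin (2*n)} (h : IsDeal n π) (hw : w ∉ W)
    (hπw : π w ∉ W) (hz : z ∈ freePartners W w π) (hx : x ∈ W) : rematch w z π x = π x := by
  obtain ⟨-, hzW, hzπ⟩ := mem_freePartners.1 hz
  have hxw : x ≠ w := fun e => hw (e ▸ hx)
  have hxπ : x ≠ π w := fun e => hπw (e ▸ hx)
  have hxz : x ≠ z := fun e => hzW (e ▸ hx)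
  rw [rematch, Equiv.swap_apply_of_ne_of_ne hxπ hxz,
    Equiv.swap_apply_of_ne_of_ne (fun e => hxw (h.injective e)) (hzπ x hx)]

theorem apply_notMem_of_mem_dealsInto (hR : w ∉ R) (hπ : π ∈ dealsInto n W R) : π w ∉ W := by
  obtain ⟨h, hW⟩ := mem_dealsInto.1 hπ
  intro hm
  have := hW _ hm
  rw [(h w).1] at this
  exact hR this

theorem apply_mem_freePartners (hw : w ∉ W) (hR : w ∉ R) (hπ : π ∈ dealsInto n W R) :
    π w ∈ freePartners W w π := by
  have h := (mem_dealsInto.1 hπ).1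
  exact mem_freePartners.2 ⟨(h w).2, apply_notMem_of_mem_dealsInto hR hπ,
    fun x hx e => hw (h.injective e ▸ hx)⟩

theorem card_freePartners (hw : w ∉ W) (hR : w ∉ R) (hd : Disjoint W R)
    (hπ : π ∈ dealsInto n W R) :
    ((freePartners W w π).card : ℝ) = 2 * n - 1 - 2 * W.card := by
  obtain ⟨h, hW⟩ := mem_dealsInto.1 hπ
  have hdis : Disjoint W (W.image π) := by
    refine hd.mono_right fun y hy => ?_
    obtain ⟨x, hx, rfl⟩ := Finset.mem_image.1 hy
    exact hW x hx
  have hwn : w ∉ W ∪ W.image π := by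
    simp only [Finset.mem_union, Finset.mem_image, not_or, not_exists, not_and]
    exact ⟨hw, fun x hx e => hR (e ▸ hW x hx)⟩
  have hc := Finset.card_sdiff_add_card_eq_card
    (Finset.subset_univ (insert w (W ∪ W.image π)))
  rw [Finset.card_insert_of_notMem hwn, Finset.card_union_of_disjoint hdis,
    Finset.card_image_of_injective _ h.injective, Finset.card_univ, Fintype.card_fin] at hc
  have hc' : ((freePartners W w π).card : ℝ) + (W.card + W.card + 1) = 2 * n := by
    exact_mod_cast hc
  linarith

theorem card_freePartners_inter (hR : w ∉ R) (hd : Disjoint W R) (hπ : π ∈ dealsInto n W R) :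
    (((freePartners W w π) ∩ R).card : ℝ) = R.card - W.card := by
  obtain ⟨h, hW⟩ := mem_dealsInto.1 hπ
  have hsub : W.image π ⊆ R := fun y hy => by
    obtain ⟨x, hx, rfl⟩ := Finset.mem_image.1 hy
    exact hW x hx
  have he : freePartners W w π ∩ R = R \ W.image π := by
    ext z
    simp only [Finset.mem_inter, mem_freePartners, Finset.mem_sdiff, Finset.mem_image, not_exists,
      not_and]
    exact ⟨fun hz => ⟨hz.2, hz.1.2.2⟩, fun hz => ⟨⟨fun e => hR (e ▸ hz.1),
      Finset.disjoint_right.1 hd hz.1, hz.2⟩, hz.1⟩⟩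
  have hc := Finset.card_sdiff_add_card_eq_card hsub
  rw [Finset.card_image_of_injective _ h.injective] at hc
  rw [he, ← hc]
  push_cast
  ring

theorem rematch_mem_dealsInto {z : Fin (2*n)} (hw : w ∉ W) (hR : w ∉ R)
    (hπ : π ∈ dealsInto n W R) (hz : z ∈ freePartners W w π) :
    rematch w z π ∈ dealsInto n W R ∧ π w ∈ freePartners W w (rematch w z π) := by
  obtain ⟨h, hW⟩ := mem_dealsInto.1 hπ
  have hπw := apply_notMem_of_mem_dealsInto hR hπ
  have hfix : ∀ x ∈ W, rematch w z π x = π x := fun x hx =>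
    rematch_apply_of_mem h hw hπw hz hx
  refine ⟨mem_dealsInto.2 ⟨h.rematch w z, fun x hx => hfix x hx ▸ hW x hx⟩, ?_⟩
  obtain ⟨h1, h2, h3⟩ := mem_freePartners.1 (apply_mem_freePartners hw hR hπ)
  exact mem_freePartners.2 ⟨h1, h2, fun x hx => hfix x hx ▸ h3 x hx⟩

/-- Given the partners of `W`, the partner of `w` is uniform on the free positions. -/
theorem card_dealsInto_insert (hw : w ∉ W) (hR : w ∉ R) (hd : Disjoint W R) :
    ((dealsInto n (insert w W) R).card : ℝ) * (2 * n - 1 - 2 * W.card) =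
      (dealsInto n W R).card * (R.card - W.card) := by
  have hbij : ((dealsInto n (insert w W) R).sigma fun π => freePartners W w π).card =
      ((dealsInto n W R).sigma fun π => freePartners W w π ∩ R).card := by
    have hins : ∀ π, π ∈ dealsInto n (insert w W) R ↔ π ∈ dealsInto n W R ∧ π w ∈ R := by
      intro π
      simp only [mem_dealsInto, Finset.forall_mem_insert]
      tauto
    refine Finset.card_nbij' (fun p => ⟨rematch w p.2 p.1, p.1 w⟩)
      (fun p => ⟨rematch w p.2 p.1, p.1 w⟩) ?_ ?_ ?_ ?_
    · rintro ⟨π, z⟩ hp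
      simp only [Finset.coe_sigma, Set.mem_sigma_iff, Finset.mem_coe, hins,
        Finset.mem_inter] at hp ⊢
      obtain ⟨⟨h1, h2⟩, h3⟩ := hp
      obtain ⟨h4, h5⟩ := rematch_mem_dealsInto hw hR h1 h3
      exact ⟨h4, h5, h2⟩
    · rintro ⟨π, z⟩ hp
      simp only [Finset.coe_sigma, Set.mem_sigma_iff, Finset.mem_coe, hins,
        Finset.mem_inter] at hp ⊢
      obtain ⟨h1, h3, h2⟩ := hp
      obtain ⟨h4, h5⟩ := rematch_mem_dealsInto hw hR h1 h3
      refine ⟨⟨h4, ?_⟩, h5⟩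
      rwa [rematch_apply_self (mem_dealsInto.1 h1).1 (mem_freePartners.1 h3).1]
    · rintro ⟨π, z⟩ hp
      simp only [Finset.coe_sigma, Set.mem_sigma_iff, Finset.mem_coe, hins] at hp
      have h := (mem_dealsInto.1 hp.1.1).1
      have hz := (mem_freePartners.1 hp.2).1
      simp only [rematch_rematch h hz, rematch_apply_self h hz]
    · rintro ⟨π, z⟩ hp
      simp only [Finset.coe_sigma, Set.mem_sigma_iff, Finset.mem_coe, Finset.mem_inter] at hp
      have h := (mem_dealsInto.1 hp.1).1
      have hz := (mem_freePartners.1 hp.2.1).1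
      simp only [rematch_rematch h hz, rematch_apply_self h hz]
  have hsub : dealsInto n (insert w W) R ⊆ dealsInto n W R := fun π hπ => by
    rw [mem_dealsInto] at hπ ⊢
    exact ⟨hπ.1, fun x hx => hπ.2 x (Finset.mem_insert_of_mem hx)⟩
  rw [Finset.card_sigma, Finset.card_sigma] at hbij
  have hbij' := congrArg (Nat.cast : ℕ → ℝ) hbij
  push_cast at hbij'
  rw [Finset.sum_congr rfl fun π hπ => card_freePartners hw hR hd (hsub hπ),
    Finset.sum_congr rfl fun π hπ => card_freePartners_inter hR hd hπ] at hbij'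
  simpa only [Finset.sum_const, nsmul_eq_mul] using hbij'

theorem card_dealsInto (hd : Disjoint W R) :
    ((dealsInto n W R).card : ℝ) * ∏ i ∈ Finset.range W.card, (2 * (n : ℝ) - 1 - 2 * i) =
      (deals n).card * (R.card.descFactorial W.card : ℕ) := by
  induction W using Finset.induction_on with
  | empty => simp [dealsInto]
  | insert w W hw ih =>
    rw [Finset.disjoint_insert_left] at hd
    rw [Finset.card_insert_of_notMem hw, Finset.prod_range_succ, Nat.descFactorial_succ]
    have hstep := card_dealsInto_insert hw hd.1 hd.2
    have hsub : ((R.card - W.card : ℕ) : ℝ) * (R.card.descFactorial W.card : ℕ) =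
        (R.card - W.card) * (R.card.descFactorial W.card : ℕ) := by
      rcases le_or_gt W.card R.card with h | h
      · rw [Nat.cast_sub h]
      · simp [Nat.descFactorial_eq_zero_iff_lt.2 h]
    rw [Nat.cast_mul, hsub]
    linear_combination (∏ i ∈ Finset.range W.card, (2 * (n : ℝ) - 1 - 2 * i)) * hstep +
      ((R.card : ℝ) - W.card) * ih hd.2

end Count

/-! ### Block lengths and windows without second occurrences -/

/-- The second difference of `m ↦ ∑ (d - m)` counts the entries of a list. -/
theorem List.count_add_two_mul_sum_tsub (L : List ℕ) (m : ℕ) :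
    L.count (m + 1) + 2 * (L.map (· - (m + 1))).sum =
      (L.map (· - m)).sum + (L.map (· - (m + 2))).sum := by
  induction L with
  | nil => simp
  | cons d L ih =>
    simp only [List.count_cons, List.map_cons, List.sum_cons, beq_iff_eq]
    split_ifs <;> omega

/-- The windows `[s, s + m)` with `a ≤ s` that contain no `y - 1` with `y ∈ l` and end at or
before some such position. -/
noncomputable def gapWindows (M m a : ℕ) (l : List ℕ) : Finset ℕ :=
  (Finset.range M).filter fun s =>
    a ≤ s ∧ (∃ y ∈ l, s + m < y) ∧ ∀ y ∈ l, ¬ (s < y ∧ y ≤ s + m)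

theorem sum_tsub_eq_card_gapWindows (M m : ℕ) (l : List ℕ) (a : ℕ)
    (hl : (a :: l).Pairwise (· < ·)) (hM : ∀ y ∈ l, y ≤ M) :
    ((List.zipWith (fun x y => x - y) l (a :: l)).map (· - m)).sum =
      (gapWindows M m a l).card := by
  induction l generalizing a with
  | nil => simp [gapWindows]
  | cons y l ih =>
    have hl' := (List.pairwise_cons.1 hl).2
    have hay : a < y := (List.pairwise_cons.1 hl).1 y (by simp)
    have hy : ∀ x ∈ l, y < x := (List.pairwise_cons.1 hl').1
    have hyM := hM y (by simp)
    have hsplit : gapWindows M m a (y :: l) =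
        Finset.Ico a (y - m) ∪ gapWindows M m y l := by
      ext s
      simp only [gapWindows, Finset.mem_filter, Finset.mem_range, List.mem_cons, exists_eq_or_imp,
        forall_eq_or_imp, Finset.mem_union, Finset.mem_Ico]
      constructor
      · rintro ⟨h1, h2, h3, h4, h5⟩
        by_cases hs : s < y
        · left; omega
        · right
          exact ⟨h1, by omega, h3.resolve_left (by omega), h5⟩
      · rintro (h | ⟨h1, h2, h3, h4⟩)
        · refine ⟨by omega, by omega, Or.inl (by omega), by omega, fun x hx => ?_⟩
          have := hy x hx
          omega
        · exact ⟨h1, by omega, Or.inr h3, by omega, h4⟩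
    have hdisj : Disjoint (Finset.Ico a (y - m)) (gapWindows M m y l) := by
      rw [Finset.disjoint_left]
      intro s hs hs'
      simp only [gapWindows, Finset.mem_filter, Finset.mem_Ico] at hs hs'
      omega
    rw [hsplit, Finset.card_union_of_disjoint hdisj, Nat.card_Ico,
      ← ih y hl' fun x hx => hM x (by simp [hx])]
    simp only [List.zipWith_cons_cons, List.map_cons, List.sum_cons]
    omega

/-- The positions of the window `[s, s + m)`. -/
def window (n s m : ℕ) : Finset (Fin (2*n)) :=
  Finset.univ.filter fun x => s ≤ (x : ℕ) ∧ (x : ℕ) < s + m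

/-- The positions at or after `t`. -/
def positionsFrom (n t : ℕ) : Finset (Fin (2*n)) :=
  Finset.univ.filter fun x => t ≤ (x : ℕ)

theorem mem_window {n s m : ℕ} {x : Fin (2*n)} :
    x ∈ window n s m ↔ s ≤ (x : ℕ) ∧ (x : ℕ) < s + m := by
  simp [window]

theorem mem_positionsFrom {n t : ℕ} {x : Fin (2*n)} :
    x ∈ positionsFrom n t ↔ t ≤ (x : ℕ) := by
  simp [positionsFrom]

theorem card_positionsFrom (n t : ℕ) : (positionsFrom n t).card = 2 * n - t := by
  rw [← Finset.card_map Fin.valEmbedding, ← Nat.card_Ico]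
  congr 1
  ext y
  simp only [Finset.mem_map, mem_positionsFrom, Fin.valEmbedding_apply, Finset.mem_Ico]
  exact ⟨fun ⟨x, hx, e⟩ => ⟨e ▸ hx, e ▸ x.2⟩, fun h => ⟨⟨y, h.2⟩, h.1, rfl⟩⟩

theorem card_window {n s m : ℕ} (h : s + m ≤ 2 * n) : (window n s m).card = m := by
  rw [← Finset.card_map Fin.valEmbedding]
  conv_rhs => rw [← Nat.add_sub_cancel_left (n := s) (m := m), ← Nat.card_Ico]
  congr 1
  ext y
  simp only [Finset.mem_map, mem_window, Fin.valEmbedding_apply, Finset.mem_Ico]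
  exact ⟨fun ⟨x, hx, e⟩ => e ▸ hx, fun hy => ⟨⟨y, by omega⟩, hy, rfl⟩⟩

theorem disjoint_window_positionsFrom (n s m : ℕ) :
    Disjoint (window n s m) (positionsFrom n (s + m)) := by
  rw [Finset.disjoint_left]
  intro x hx hx'
  have := (mem_window.1 hx).2
  have := mem_positionsFrom.1 hx'
  omega

theorem mem_blockEnds {n : ℕ} {π : Fin (2*n) → Fin (2*n)} {p : Fin (2*n)} :
    p ∈ blockEnds π ↔ π p < p := by
  simp [blockEnds]

/-- In a deal, a nonempty window avoids the second occurrences exactly when all its positions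
are matched with positions beyond it. -/
theorem gapWindows_blockEnds {n m : ℕ} (hm : 1 ≤ m) {π : Fin (2*n) → Fin (2*n)}
    (hπ : IsDeal n π) :
    gapWindows (2*n) m 0 ((blockEnds π).map fun p : Fin (2*n) => (p : ℕ) + 1) =
      (Finset.range (2*n + 1 - m)).filter fun s =>
        ∀ x ∈ window n s m, π x ∈ positionsFrom n (s + m) := by
  ext s
  simp only [gapWindows, Finset.mem_filter, Finset.mem_range, List.mem_map, mem_blockEnds,
    mem_window, mem_positionsFrom]
  constructor
  · rintro ⟨hs, -, ⟨y, ⟨p, hp, rfl⟩, hsp⟩, hy⟩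
    refine ⟨by omega, fun x hx => ?_⟩
    by_contra hlt
    have h1 : ¬ π x < x := fun h => hy _ ⟨x, h, rfl⟩ (by omega)
    have h2 : ¬ x < π x := fun h => by
      refine hy _ ⟨π x, by rwa [(hπ x).1], rfl⟩ ?_
      rw [Fin.lt_def] at h
      omega
    exact (hπ x).2 (le_antisymm (not_lt.1 h2) (not_lt.1 h1))
  · rintro ⟨hs, hw⟩
    have h0 := hw ⟨s, by omega⟩ (by simp; omega)
    refine ⟨by omega, by omega, ⟨_, ⟨π ⟨s, by omega⟩, ?_, rfl⟩, by omega⟩, ?_⟩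
    · rw [(hπ _).1, Fin.lt_def]
      simp only
      omega
    · rintro y ⟨p, hp, rfl⟩ hsp
      have := hw p (by omega)
      rw [Fin.lt_def] at hp
      omega

theorem blockLens_eq {n : ℕ} (π : Fin (2*n) → Fin (2*n)) :
    blockLens π = List.zipWith (fun x y => x - y)
      ((blockEnds π).map fun p : Fin (2*n) => (p : ℕ) + 1)
      (0 :: (blockEnds π).map fun p : Fin (2*n) => (p : ℕ) + 1) := by
  simp [blockLens, ← List.map_eq_flatMap, Function.comp_def]

theorem sum_blockLens_tsub {n m : ℕ} (hm : 1 ≤ m) {π : Fin (2*n) → Fin (2*n)}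
    (hπ : IsDeal n π) :
    ((blockLens π).map (· - m)).sum =
      ((Finset.range (2*n + 1 - m)).filter fun s =>
        ∀ x ∈ window n s m, π x ∈ positionsFrom n (s + m)).card := by
  rw [← gapWindows_blockEnds hm hπ, blockLens_eq]
  refine sum_tsub_eq_card_gapWindows _ _ _ _ (List.pairwise_cons.2 ⟨by simp, ?_⟩) ?_
  · rw [List.pairwise_map]
    refine (Finset.sortedLT_sort _).pairwise.imp fun h => ?_
    rw [Fin.lt_def] at h
    omega
  · simp only [List.mem_map, forall_exists_index, and_imp]
    rintro y p - rfl
    omega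

/-! ### The mean number of windows -/

/-- The mean number of windows of length `m` free of second occurrences in a deal of size `n`. -/
noncomputable def windowMean (n m : ℕ) : ℝ :=
  (m ! * (2 * n + 1 - m).choose (m + 1) : ℕ) / ∏ i ∈ Finset.range m, (2 * (n : ℝ) - 1 - 2 * i)

theorem odd_factor_ne_zero (n i : ℕ) : 2 * (n : ℝ) - 1 - 2 * i ≠ 0 := by
  intro h
  have h' : (2 * (n : ℤ) - 1 - 2 * i) = 0 := by exact_mod_cast h
  omega

theorem windowMean_zero (n : ℕ) : windowMean n 0 = 2 * n + 1 := by
  simp [windowMean]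

theorem windowMean_eq_zero {n m : ℕ} (h : n < m) : windowMean n m = 0 := by
  rw [windowMean, Nat.choose_eq_zero_of_lt (by omega)]; simp

theorem windowMean_succ (n m : ℕ) :
    (2 * (n : ℝ) + 1) * windowMean (n + 1) (m + 1) =
      (2 * n + 1 - m) * windowMean n (m + 1) + (m + 1) * windowMean n m := by
  rcases le_or_gt (2 * n) m with h | h
  · rcases Nat.eq_zero_or_pos n with rfl | hn
    · rcases Nat.eq_zero_or_pos m with rfl | hm
      · norm_num [windowMean]
      · rw [windowMean_eq_zero (by omega), windowMean_eq_zero (by omega),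
          windowMean_eq_zero (by omega)]; simp
    · rw [windowMean_eq_zero (by omega), windowMean_eq_zero (by omega),
        windowMean_eq_zero (by omega)]; simp
  · obtain ⟨N, hN⟩ : ∃ N, 2 * n = N + m := ⟨2 * n - m, by omega⟩
    have hNr : 2 * (n : ℝ) = N + m := by exact_mod_cast hN
    have e1 : 2 * (n + 1) + 1 - (m + 1) = N + 2 := by omega
    have e2 : 2 * n + 1 - (m + 1) = N := by omega
    have e3 : 2 * n + 1 - m = N + 1 := by omega
    have hP := Finset.prod_ne_zero_iff.2 (fun i (_ : i ∈ Finset.range m) => odd_factor_ne_zero n i)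
    have hl := odd_factor_ne_zero n m
    have hn1 : 2 * (n : ℝ) + 1 ≠ 0 := by positivity
    have hprod : ∏ i ∈ Finset.range (m + 1), (2 * ((n + 1 : ℕ) : ℝ) - 1 - 2 * i) =
        (2 * n + 1) * ∏ i ∈ Finset.range m, (2 * (n : ℝ) - 1 - 2 * i) := by
      rw [Finset.prod_range_succ', mul_comm]
      congr 1
      · push_cast; ring
      · exact Finset.prod_congr rfl fun i _ => by push_cast; ring
    have hc : ((N + 1 : ℕ) : ℝ) * N.choose (m + 2) =
        (N + 1).choose (m + 2) * (N + 1 - (m + 2)) := by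
      have := Nat.add_one_mul_choose_eq N (m + 1)
      have h2 := Nat.choose_succ_succ N (m + 1)
      have h3 : ((N : ℝ) + 1) * N.choose (m + 1) = (N + 1).choose (m + 2) * (m + 2) := by
        exact_mod_cast this
      have h4 : ((N + 1).choose (m + 2) : ℝ) = N.choose (m + 1) + N.choose (m + 2) := by
        exact_mod_cast h2
      push_cast
      linear_combination -((N : ℝ) + 1) * h4 - h3
    have hp : ((N + 2).choose (m + 2) : ℝ) = (N + 1).choose (m + 1) + (N + 1).choose (m + 2) := by
      exact_mod_cast Nat.choose_succ_succ (N + 1) (m + 1)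
    simp only [windowMean, e1, e2, e3, hprod]
    rw [Finset.prod_range_succ]
    push_cast [Nat.factorial_succ] at hc ⊢
    have hl' : (N : ℝ) - m - 1 ≠ 0 := by
      intro h0; exact hl (by linarith)
    have hl2 : 2 * (n : ℝ) - 1 - 2 * m = N - m - 1 := by linarith
    rw [hl2]
    field_simp
    rw [hp, hNr]
    linear_combination (-1 : ℝ) * hc

theorem sum_range_descFactorial (N m : ℕ) :
    ∑ r ∈ Finset.range N, r.descFactorial m = m ! * N.choose (m + 1) := by
  induction N with
  | zero => simp
  | succ N ih =>
    rw [Finset.sum_range_succ, ih, Nat.descFactorial_eq_factorial_mul_choose,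
      Nat.choose_succ_succ]
    ring

theorem sum_deals_blockLens_tsub {n m : ℕ} (hm : 1 ≤ m) :
    ((∑ π ∈ deals n, ((blockLens π).map (· - m)).sum : ℕ) : ℝ) =
      (deals n).card * windowMean n m := by
  have hswap : ∑ π ∈ deals n, ((blockLens π).map (· - m)).sum =
      ∑ s ∈ Finset.range (2*n + 1 - m),
        (dealsInto n (window n s m) (positionsFrom n (s + m))).card := by
    rw [Finset.sum_congr rfl fun π hπ => sum_blockLens_tsub hm (mem_deals.1 hπ)]
    simp only [Finset.card_filter, dealsInto]
    exact Finset.sum_comm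
  have hP := Finset.prod_ne_zero_iff.2 (fun i (_ : i ∈ Finset.range m) => odd_factor_ne_zero n i)
  rw [hswap, windowMean, mul_div_assoc', eq_div_iff hP, ← sum_range_descFactorial,
    ← Finset.sum_range_reflect (fun r => r.descFactorial m)]
  push_cast
  rw [Finset.sum_mul, Finset.mul_sum]
  refine Finset.sum_congr rfl fun s hs => ?_
  have hs' := Finset.mem_range.1 hs
  have h := card_dealsInto (disjoint_window_positionsFrom n s m)
  rw [card_window (by omega), card_positionsFrom] at h
  rw [h, show 2 * n + 1 - m - 1 - s = 2 * n - (s + m) by omega]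

theorem eb_eq_windowMean (n k : ℕ) (hk : 1 ≤ k) :
    eb n (k + 1) = windowMean n k - 2 * windowMean n (k + 1) + windowMean n (k + 2) := by
  have hcard : ((deals n).card : ℝ) ≠ 0 := by
    exact_mod_cast (deals_nonempty n).card_pos.ne'
  have hsum : bcount n (k + 1) + 2 * ∑ π ∈ deals n, ((blockLens π).map (· - (k + 1))).sum =
      ∑ π ∈ deals n, ((blockLens π).map (· - k)).sum +
        ∑ π ∈ deals n, ((blockLens π).map (· - (k + 2))).sum := by
    rw [bcount, Finset.mul_sum, ← Finset.sum_add_distrib, ← Finset.sum_add_distrib]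
    exact Finset.sum_congr rfl fun π _ => List.count_add_two_mul_sum_tsub _ _
  have hsum_real := congrArg (Nat.cast : ℕ → ℝ) hsum
  rw [Nat.cast_add, Nat.cast_add, Nat.cast_mul, sum_deals_blockLens_tsub hk,
    sum_deals_blockLens_tsub (by omega), sum_deals_blockLens_tsub (by omega)] at hsum_real
  rw [eb, div_eq_iff hcard]
  push_cast at hsum_real
  linear_combination hsum_real

/-! ### Deviation from the limiting means -/

/-- The deviation of `windowMean n m` from `(2 * n + 1) / (m + 1)`. -/
noncomputable def windowDeviation (n m : ℕ) : ℝ :=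
  windowMean n m - (2 * n + 1) / (m + 1)

/-- The second difference of `windowDeviation n`, which is `db n (k + 1)` for `1 ≤ k`. -/
noncomputable def blockDeviation (n k : ℕ) : ℝ :=
  windowDeviation n k - 2 * windowDeviation n (k + 1) + windowDeviation n (k + 2)

theorem blockDeviation_eq (n k : ℕ) :
    blockDeviation n k = windowMean n k - 2 * windowMean n (k + 1) + windowMean n (k + 2) -
      2 * (2 * (n : ℝ) + 1) / (((k + 1 : ℕ) : ℝ) * (((k + 1 : ℕ) : ℝ) + 1) *
        (((k + 1 : ℕ) : ℝ) + 2)) := by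
  have h1 : (k : ℝ) + 1 ≠ 0 := by positivity
  have h2 : (k : ℝ) + 1 + 1 ≠ 0 := by positivity
  have h3 : (k : ℝ) + 2 + 1 ≠ 0 := by positivity
  have h4 : (k : ℝ) + 1 + 2 ≠ 0 := by positivity
  rw [blockDeviation, windowDeviation, windowDeviation, windowDeviation]
  push_cast
  field_simp
  ring

theorem db_eq_blockDeviation (n k : ℕ) (hk : 1 ≤ k) : db n (k + 1) = blockDeviation n k := by
  rw [db, eb_eq_windowMean n k hk, blockDeviation_eq]

theorem windowDeviation_zero (n : ℕ) : windowDeviation n 0 = 0 := by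
  simp [windowDeviation, windowMean_zero]

theorem windowDeviation_succ (n m : ℕ) :
    (2 * (n : ℝ) + 1) * windowDeviation (n + 1) (m + 1) =
      (2 * n + 1 - m) * windowDeviation n (m + 1) + (m + 1) * windowDeviation n m := by
  have h1 : (m : ℝ) + 1 ≠ 0 := by positivity
  have h2 : (m : ℝ) + 1 + 1 ≠ 0 := by positivity
  have h := windowMean_succ n m
  simp only [windowDeviation]
  push_cast
  rw [mul_sub, h]
  field_simp
  ring

theorem blockDeviation_succ (n k : ℕ) :
    (2 * (n : ℝ) + 1) * blockDeviation (n + 1) (k + 1) =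
      (k + 1) * blockDeviation n k + (2 * n - 1 - k) * blockDeviation n (k + 1) := by
  have h1 := windowDeviation_succ n k
  have h2 := windowDeviation_succ n (k + 1)
  have h3 := windowDeviation_succ n (k + 2)
  push_cast at h2 h3
  simp only [blockDeviation]
  linear_combination h1 - 2 * h2 + h3

theorem blockDeviation_zero {n : ℕ} (hn : 1 ≤ n) : blockDeviation n 0 = 0 := by
  suffices windowDeviation n 1 = -1 / 2 ∧ windowDeviation n 2 = -1 by
    rw [blockDeviation, windowDeviation_zero, this.1, this.2]
    norm_num
  induction n, hn using Nat.le_induction with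
  | base => norm_num [windowDeviation, windowMean, Nat.choose]
  | succ n _ ih =>
    have hn1 : 2 * (n : ℝ) + 1 ≠ 0 := by positivity
    have h1 := windowDeviation_succ n 0
    have h2 := windowDeviation_succ n 1
    simp only [Nat.reduceAdd, ih.1, ih.2, windowDeviation_zero] at h1 h2
    push_cast at h1 h2
    exact ⟨mul_left_cancel₀ hn1 (by linear_combination h1),
      mul_left_cancel₀ hn1 (by linear_combination h2)⟩

/-- Blocks longer than `n + 1` do not occur. -/
theorem abs_blockDeviation_of_lt {n k : ℕ} (h : n < k) :
    |blockDeviation n k| = 2 * (2 * (n : ℝ) + 1) / ((k + 1) * (k + 2) * (k + 3)) := by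
  rw [blockDeviation_eq, windowMean_eq_zero h, windowMean_eq_zero (by omega),
    windowMean_eq_zero (by omega), mul_zero, sub_zero, add_zero, zero_sub, abs_neg,
    abs_of_nonneg (by positivity)]
  push_cast
  ring

theorem abs_blockDeviation_le {n : ℕ} (hn : 1 ≤ n) (k : ℕ) :
    |blockDeviation n k| ≤
      (3/4) * ∏ i ∈ Finset.Icc 1 (n-1), (2*(i:ℝ))/(2*(i:ℝ)+1) := by
  suffices H : 1 / (2 * (n : ℝ) - 1) ≤ ∏ i ∈ Finset.Icc 1 (n-1), (2*(i:ℝ))/(2*(i:ℝ)+1) ∧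
      ∀ k, |blockDeviation n k| ≤
        (3/4) * ∏ i ∈ Finset.Icc 1 (n-1), (2*(i:ℝ))/(2*(i:ℝ)+1) from H.2 k
  clear k
  induction n, hn using Nat.le_induction with
  | base =>
    refine ⟨by norm_num, fun k => ?_⟩
    rcases k with _ | _ | k
    · rw [blockDeviation_zero le_rfl]; norm_num
    · norm_num [blockDeviation, windowDeviation, windowMean, Nat.choose, Nat.factorial]
    · rw [abs_blockDeviation_of_lt (by omega), div_le_iff₀ (by positivity)]
      push_cast
      norm_num
      have : (0 : ℝ) ≤ k := k.cast_nonneg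
      nlinarith [mul_nonneg this this, mul_nonneg (mul_nonneg this this) this]
  | succ n hn ih =>
    obtain ⟨hP, ih⟩ := ih
    have hn_real : (1 : ℝ) ≤ n := by exact_mod_cast hn
    have hstep : ∏ i ∈ Finset.Icc 1 (n+1-1), (2*(i:ℝ))/(2*(i:ℝ)+1) =
        (∏ i ∈ Finset.Icc 1 (n-1), (2*(i:ℝ))/(2*(i:ℝ)+1)) * (2*(n:ℝ)/(2*(n:ℝ)+1)) := by
      obtain ⟨r, rfl⟩ : ∃ r, n = r + 1 := ⟨n - 1, by omega⟩
      exact Finset.prod_Icc_succ_top (by omega) _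
    rw [hstep]
    set P := ∏ i ∈ Finset.Icc 1 (n-1), (2*(i:ℝ))/(2*(i:ℝ)+1)
    have hd : (0 : ℝ) < 2 * n + 1 := by positivity
    have hP' : 1 / (2 * (n : ℝ) + 1) ≤ P * (2 * n / (2 * n + 1)) := by
      rw [mul_div_assoc']
      refine div_le_div_of_nonneg_right ?_ hd.le
      rw [div_le_iff₀ (by linarith)] at hP
      have : 0 ≤ P := nonneg_of_mul_nonneg_left (zero_le_one.trans hP) (by linarith)
      linarith
    refine ⟨?_, fun k => ?_⟩
    · push_cast
      convert hP' using 2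
      ring
    · rcases k with _ | k
      · rw [blockDeviation_zero (by omega), abs_zero]
        have : 0 < 1 / (2 * (n : ℝ) + 1) := by positivity
        linarith
      · rcases le_or_gt (k + 1) (2 * n) with hk | hk
        · have hk' : (k : ℝ) + 1 ≤ 2 * n := by exact_mod_cast hk
          have habs : (2 * (n : ℝ) + 1) * |blockDeviation (n + 1) (k + 1)| ≤
              2 * n * (3/4 * P) := by
            rw [← abs_of_pos hd, ← abs_mul, blockDeviation_succ]
            refine (abs_add_le _ _).trans ?_
            rw [abs_mul, abs_mul, abs_of_nonneg (by positivity : (0 : ℝ) ≤ k + 1),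
              abs_of_nonneg (by linarith : (0 : ℝ) ≤ 2 * n - 1 - k)]
            have h1 := mul_le_mul_of_nonneg_left (ih k) (by positivity : (0 : ℝ) ≤ k + 1)
            have h2 := mul_le_mul_of_nonneg_left (ih (k + 1))
              (by linarith : (0 : ℝ) ≤ 2 * n - 1 - k)
            linarith
          rw [← mul_le_mul_iff_right₀ hd]
          refine habs.trans_eq ?_
          field_simp
        · have hk' : 2 * (n : ℝ) + 1 ≤ k + 1 := by exact_mod_cast hk
          rw [abs_blockDeviation_of_lt (by omega)]
          refine le_trans ?_ (mul_le_mul_of_nonneg_left hP' (by norm_num))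
          push_cast
          calc 2 * (2 * ((n : ℝ) + 1) + 1) / ((k + 1 + 1) * (k + 1 + 2) * (k + 1 + 3))
              ≤ 2 * (2 * ((n : ℝ) + 1) + 1) /
                  ((2 * n + 2) * (2 * n + 3) * (2 * n + 4)) := by
                have h1 : 2 * (n : ℝ) + 2 ≤ k + 1 + 1 := by linarith
                have h2 : 2 * (n : ℝ) + 3 ≤ k + 1 + 2 := by linarith
                have h3 : 2 * (n : ℝ) + 4 ≤ k + 1 + 3 := by linarith
                exact div_le_div_of_nonneg_left (by positivity) (by positivity)
                  (mul_le_mul (mul_le_mul h1 h2 (by positivity) (by positivity)) h3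
                    (by positivity) (by positivity))
            _ ≤ 3 / 4 * (1 / (2 * n + 1)) := by
                rw [mul_one_div, div_le_div_iff₀ (by positivity) hd]
                nlinarith [mul_nonneg (sub_nonneg.2 hn_real) (sub_nonneg.2 hn_real),
                  pow_nonneg (sub_nonneg.2 hn_real) 3]

/-- For `n ≥ 1` and `j ≥ 2`,
`|db(n,j)| ≤ (3/4)·(2·4·6⋯(2n-2))/(3·5·7⋯(2n-1))`. -/
theorem abs_db_le (n j : ℕ) (hn : 1 ≤ n) (hj : 2 ≤ j) :
    |db n j| ≤ (3/4) * ∏ k ∈ Finset.Icc 1 (n-1), (2*(k:ℝ))/(2*(k:ℝ)+1) := by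
  obtain ⟨k, rfl⟩ : ∃ k, j = k + 1 := ⟨j - 1, by omega⟩
  rw [db_eq_blockDeviation n k (by omega)]
  exact abs_blockDeviation_le hn k
end

section
/- For every integer n ≥ 1, the total over all deals π ∈ D_n of the number of positions j ∈ Fin (2n) with j ≥ 1 and π(j) = j − 1 equals |D_n| = (2n)!/(2^n · n!). In other words, the expected number of adjacent matching pairs (equivalently, of lucky blocks) in a random deal is exactly 1. -/
open scoped Classical

theorem Equiv.Perm.exists_apply_eq_and_apply_eq {α : Type*} {a b c d : α}
    (hab : a ≠ b) (hcd : c ≠ d) : ∃ e : Equiv.Perm α, e a = c ∧ e b = d := by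
  refine ⟨Equiv.swap (Equiv.swap a c b) d * Equiv.swap a c, ?_, by simp⟩
  have hc : c ≠ Equiv.swap a c b := fun h => hab <| by
    simpa using congrArg (Equiv.swap a c) h
  simp [Equiv.swap_apply_of_ne_of_ne hc hcd]

theorem IsDeal.conj {n : ℕ} {π : Fin (2*n) → Fin (2*n)} (h : IsDeal n π)
    (e : Equiv.Perm (Fin (2*n))) : IsDeal n (fun j => e (π (e.symm j))) := by
  intro j
  refine ⟨by simp [(h _).1], fun hj => (h (e.symm j)).2 ?_⟩
  exact e.eq_symm_apply.mpr hj

theorem card_deals_filter_apply_le {n : ℕ} {a b c d : Fin (2*n)} (hab : a ≠ b) (hcd : c ≠ d) :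
    ((deals n).filter (fun π => π a = b)).card ≤ ((deals n).filter (fun π => π c = d)).card := by
  obtain ⟨e, hea, heb⟩ := Equiv.Perm.exists_apply_eq_and_apply_eq hab hcd
  refine Finset.card_le_card_of_injOn (fun π j => e (π (e.symm j))) ?_ ?_
  · intro π hπ
    simp only [deals, Finset.coe_filter, Finset.mem_filter, Finset.mem_univ, true_and,
      Set.mem_ofPred_eq] at hπ ⊢
    refine ⟨hπ.1.conj e, ?_⟩
    rw [← hea, e.symm_apply_apply, hπ.2, heb]
  · intro π _ ρ _ h
    funext j
    simpa using congrFun h (e j)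

/-- The number of deals matching two given distinct positions does not depend on the positions. -/
theorem card_deals_filter_apply_eq {n : ℕ} {a b c d : Fin (2*n)} (hab : a ≠ b) (hcd : c ≠ d) :
    ((deals n).filter (fun π => π a = b)).card = ((deals n).filter (fun π => π c = d)).card :=
  (card_deals_filter_apply_le hab hcd).antisymm (card_deals_filter_apply_le hcd hab)

theorem isDeal_coe_iff_cycleType {n : ℕ} (σ : Equiv.Perm (Fin (2*n))) :
    IsDeal n σ ↔ σ.cycleType = Multiset.replicate n 2 := by
  have hsq : σ ^ 2 = 1 ↔ ∀ j, σ (σ j) = j := by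
    simp [Equiv.ext_iff, pow_two]
  have hsupp : σ.support.card = 2 * n ↔ ∀ j, σ j ≠ j := by
    simpa [Finset.eq_univ_iff_forall] using Finset.card_eq_iff_eq_univ σ.support
  rw [IsDeal, forall_and, ← hsq, ← hsupp, Equiv.Perm.pow_prime_eq_one_iff,
    ← Equiv.Perm.sum_cycleType, Multiset.eq_replicate, and_comm]
  refine and_congr_left fun h => ?_
  rw [Multiset.eq_replicate_card.mpr h]
  simp
  omega

theorem card_deals (n : ℕ) :
    (deals n).card = Nat.factorial (2*n) / (2^n * Nat.factorial n) := by
  have hcard : (deals n).card = (Finset.univ.filter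
      (fun σ : Equiv.Perm (Fin (2*n)) => σ.cycleType = Multiset.replicate n 2)).card := by
    symm
    refine Finset.card_bij (fun σ _ => ⇑σ) ?_ ?_ ?_
    · intro σ hσ
      simpa [deals, isDeal_coe_iff_cycleType] using hσ
    · intro σ _ τ _ h
      exact DFunLike.coe_injective h
    · intro π hπ
      have hdeal : IsDeal n π := by simpa [deals] using hπ
      have hinv : Function.Involutive π := fun j => (hdeal j).1
      refine ⟨hinv.toPerm π, ?_, hinv.coe_toPerm⟩
      simpa [← isDeal_coe_iff_cycleType] using hdeal
  have hfac : ∏ k ∈ (Multiset.replicate n 2).toFinset,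
      ((Multiset.replicate n 2).count k).factorial = n.factorial := by
    rcases Nat.eq_zero_or_pos n with rfl | hn
    · simp
    · simp [Multiset.toFinset_replicate, hn.ne']
  have h := Equiv.Perm.card_of_cycleType (Fin (2*n)) (Multiset.replicate n 2)
  rw [hcard]
  convert h using 1
  rw [if_pos ⟨by simp [mul_comm], fun a ha => (Multiset.eq_of_mem_replicate ha).ge⟩, hfac]
  simp [mul_comm]

/-- The total number of adjacent matching pairs (positions `j ≥ 1` with
`π j = j - 1`), summed over all deals in `D_n`, equals
`|D_n| = (2n)!/(2^n · n!)`; i.e. the expected number of adjacent matching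
pairs in a random deal is exactly `1`. -/
theorem total_adjacent_pairs (n : ℕ) (hn : 1 ≤ n) :
    (∑ π ∈ deals n,
        (Finset.univ.filter
          (fun j : Fin (2*n) => 1 ≤ (j : ℕ) ∧ (π j).val = (j : ℕ) - 1)).card)
      = (deals n).card ∧
    (deals n).card = Nat.factorial (2*n) / (2^n * Nat.factorial n) := by
  refine ⟨?_, card_deals n⟩
  have : NeZero (2 * n) := ⟨by omega⟩
  rw [Finset.card_eq_sum_card_fiberwise (f := fun π => π 0) (t := Finset.univ)
    (fun _ _ => Finset.mem_coe.mpr (Finset.mem_univ _))]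
  refine (Finset.sum_card_bipartiteAbove_eq_sum_card_bipartiteBelow
    (fun (π : Fin (2*n) → Fin (2*n)) (j : Fin (2*n)) =>
      1 ≤ (j : ℕ) ∧ (π j).val = (j : ℕ) - 1)).trans ?_
  refine Finset.sum_congr rfl fun j _ => ?_
  rw [Finset.bipartiteBelow]
  rcases eq_or_ne j 0 with rfl | hj
  · rw [Finset.filter_false_of_mem (by simp), Finset.filter_false_of_mem]
    intro π hπ
    exact ((Finset.mem_filter.mp hπ).2 0).2
  · have hpos : 1 ≤ (j : ℕ) := Nat.one_le_iff_ne_zero.mpr (Fin.val_ne_zero_iff.mpr hj)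
    let i : Fin (2*n) := ⟨j - 1, by omega⟩
    have hji : j ≠ i := fun h => by
      have := congrArg Fin.val h
      simp only [i] at this
      omega
    rw [← card_deals_filter_apply_eq hji hj.symm]
    congr 1
    ext π
    simp [hpos, i, Fin.ext_iff]
end
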